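/- arXiv:1208.2635 — 2 statements merged into one kernel-verified Lean document; each statement's English description precedes it below -/
import Mathlib

section
/- Fix ε > 0 and c ≥ 1, assume Conditions I((2+ε)s⋆) and I(s̄) hold, take λ = ((1+ε)·(23 + 5c) + 1)/ε·log p, and assume min_{j ∈ J⋆} |β⋆_j| ≥ 3σ·√(λ/n)/ν_{(2+ε)s⋆}. Let β̂_mean = Σ_J Π(J)·β̂_J be the posterior mean. Then with probability at least 1 − 4p^(−c) over the Gaussian noise z: ‖β̂_mean − β⋆‖_∞ ≤ σ·√(2(c+1)·log p/(n·ν_{s⋆}²)) + (3/(ν_{s̄}·p^c))·[σ·√((20+4c)·log p/n) + ‖Xβ⋆‖₂/√n + ν_{s̄}·‖β⋆‖_∞]. -/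
open MeasureTheory ProbabilityTheory Finset
open scoped Classical ENNReal

section GaussianTails

variable {E : Type*} [NormedAddCommGroup E] [InnerProductSpace ℝ E] [FiniteDimensional ℝ E]
  [MeasurableSpace E] [BorelSpace E]

lemma map_inner_stdGaussian (u : E) :
    (stdGaussian E).map (fun x => inner ℝ u x) = gaussianReal 0 (Real.toNNReal (‖u‖ ^ 2)) := by
  apply Measure.ext_of_charFun
  ext t
  rw [charFun_gaussianReal, charFun_apply_real,
    integral_map (by fun_prop) (by fun_prop)]
  have h := charFun_stdGaussian (E := E) (t • u)
  rw [charFun_apply] at h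
  have e : ∀ x : E, Complex.exp ((t : ℂ) * ((inner ℝ u x : ℝ) : ℂ) * Complex.I)
      = Complex.exp (((inner ℝ x (t • u) : ℝ) : ℂ) * Complex.I) := by
    intro x
    rw [inner_smul_right, real_inner_comm]
    push_cast
    ring_nf
  simp_rw [e]
  rw [h, norm_smul]
  congr 1
  have : ((‖t‖ * ‖u‖ : ℝ) ^ 2 : ℝ) = t ^ 2 * ‖u‖ ^ 2 := by
    rw [mul_pow, Real.norm_eq_abs, sq_abs]
  rw [← Complex.ofReal_pow, this, Real.coe_toNNReal _ (by positivity)]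
  push_cast
  ring

lemma map_orthogonalProjectionOnto_stdGaussian (W : Submodule ℝ E) :
    (stdGaussian E).map W.orthogonalProjectionOnto = stdGaussian W := by
  apply Measure.ext_of_charFun
  ext t
  rw [charFun_stdGaussian, charFun_apply, integral_map (by fun_prop) (by fun_prop)]
  have h := charFun_stdGaussian (E := E) (t : E)
  rw [charFun_apply] at h
  simp_rw [Submodule.inner_orthogonalProjectionOnto_eq_of_mem_right]
  rw [h]
  rfl

lemma stdGaussian_inner_tail (u : E) {t : ℝ} (ht : 0 ≤ t) :
    (stdGaussian E).real {x | t * ‖u‖ < inner ℝ u x} ≤ Real.exp (-(t ^ 2 / 2)) := by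
  rcases eq_or_ne u 0 with rfl | hu
  · simp [Real.exp_nonneg]
  have hu' : 0 < ‖u‖ := norm_pos_iff.2 hu
  have hmap := map_inner_stdGaussian u
  have hint : Integrable (fun x => Real.exp (t / ‖u‖ * inner ℝ u x)) (stdGaussian E) := by
    have := integrable_exp_mul_gaussianReal (μ := 0) (v := Real.toNNReal (‖u‖ ^ 2)) (t / ‖u‖)
    rw [← hmap] at this
    exact this.comp_measurable (by fun_prop)
  have h := measure_ge_le_exp_mul_mgf (μ := stdGaussian E) (X := fun x => inner ℝ u x)
    (t * ‖u‖) (t := t / ‖u‖) (by positivity) hint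
  rw [mgf_gaussianReal hmap, ← Real.exp_add, Real.coe_toNNReal _ (by positivity)] at h
  refine (measureReal_mono fun x hx => ?_).trans (h.trans (le_of_eq ?_))
  · exact le_of_lt (α := ℝ) hx
  · congr 1
    field_simp
    ring

lemma mgf_sq_gaussianReal :
    Integrable (fun x : ℝ => Real.exp (1 / 4 * x ^ 2)) (gaussianReal 0 1) ∧
      ∫ x, Real.exp (1 / 4 * x ^ 2) ∂(gaussianReal 0 1) = √2 := by
  have key : ∀ x : ℝ, gaussianPDFReal 0 1 x * Real.exp (1 / 4 * x ^ 2)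
      = (√(2 * Real.pi))⁻¹ * Real.exp (-(1 / 4) * x ^ 2) := by
    intro x
    simp only [gaussianPDFReal_def, NNReal.coe_one, mul_one, sub_zero]
    rw [mul_assoc, ← Real.exp_add]
    congr 2
    ring
  constructor
  · rw [gaussianReal_of_var_ne_zero _ one_ne_zero,
      integrable_withDensity_iff_integrable_smul' (measurable_gaussianPDF _ _)
        (by simp [gaussianPDF_lt_top])]
    simp only [toReal_gaussianPDF, smul_eq_mul, key]
    exact (integrable_exp_neg_mul_sq (by norm_num)).const_mul _
  · rw [integral_gaussianReal_eq_integral_smul one_ne_zero]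
    simp only [smul_eq_mul, key]
    rw [integral_const_mul, integral_gaussian, ← Real.sqrt_inv, ← Real.sqrt_mul (by positivity)]
    congr 1
    field_simp
    norm_num

lemma mgf_norm_sq_stdGaussian :
    Integrable (fun x : E => Real.exp (1 / 4 * ‖x‖ ^ 2)) (stdGaussian E) ∧
      ∫ x, Real.exp (1 / 4 * ‖x‖ ^ 2) ∂(stdGaussian E) = √2 ^ Module.finrank ℝ E := by
  have hnorm : ∀ y : Fin (Module.finrank ℝ E) → ℝ,
      Real.exp (1 / 4 * ‖∑ i, y i • stdOrthonormalBasis ℝ E i‖ ^ 2)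
        = ∏ i, Real.exp (1 / 4 * y i ^ 2) := by
    intro y
    rw [← Real.exp_sum, ← Finset.mul_sum, ← (stdOrthonormalBasis ℝ E).sum_sq_norm_inner_right]
    congr 2
    refine Finset.sum_congr rfl fun i _ => ?_
    rw [(stdOrthonormalBasis ℝ E).orthonormal.inner_right_fintype, Real.norm_eq_abs, sq_abs]
  constructor
  · rw [stdGaussian, integrable_map_measure (by fun_prop) (Measurable.aemeasurable (by fun_prop))]
    simp only [Function.comp_def, hnorm]
    exact Integrable.fintype_prod (fun _ => mgf_sq_gaussianReal.1)
  · rw [stdGaussian, integral_map (Measurable.aemeasurable (by fun_prop)) (by fun_prop)]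
    simp only [hnorm]
    rw [integral_fintype_prod_eq_prod (f := fun _ x => Real.exp (1 / 4 * x ^ 2))]
    simp [mgf_sq_gaussianReal.2, -one_div]

lemma stdGaussian_norm_starProjection_tail (W : Submodule ℝ E) {d : ℕ}
    (hd : Module.finrank ℝ W ≤ d) (s : ℝ) :
    (stdGaussian E).real {x | s < ‖W.starProjection x‖ ^ 2} ≤ √2 ^ d * Real.exp (-(s / 4)) := by
  have h := measure_ge_le_exp_mul_mgf (μ := stdGaussian W) (X := fun x => ‖x‖ ^ 2)
    s (t := 1 / 4) (by norm_num) mgf_norm_sq_stdGaussian.1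
  rw [mgf, mgf_norm_sq_stdGaussian.2, ← map_orthogonalProjectionOnto_stdGaussian,
    map_measureReal_apply (by fun_prop) (measurableSet_le (by fun_prop) (by fun_prop))] at h
  refine (measureReal_mono fun x hx => ?_).trans (h.trans ?_)
  · exact le_of_lt (α := ℝ) hx
  · rw [mul_comm]
    have h2 : (1 : ℝ) ≤ √2 := by rw [Real.one_le_sqrt]; norm_num
    have h3 : -(1 / 4) * s = -(s / 4) := by ring
    rw [h3]
    gcongr

lemma pi_gaussianReal_eq_map_stdGaussian (n : ℕ) {σ : ℝ} :
    Measure.pi (fun _ : Fin n => gaussianReal 0 (Real.toNNReal (σ ^ 2)))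
      = (stdGaussian (EuclideanSpace ℝ (Fin n))).map (fun v => WithLp.ofLp (σ • v)) := by
  rw [← map_pi_eq_stdGaussian, Measure.map_map (by fun_prop) (by fun_prop)]
  have h : (fun v : EuclideanSpace ℝ (Fin n) => WithLp.ofLp (σ • v)) ∘ WithLp.toLp 2
      = fun (x : Fin n → ℝ) i => σ * x i := rfl
  have hs : (gaussianReal 0 1).map (fun x => σ * x) = gaussianReal 0 (Real.toNNReal (σ ^ 2)) := by
    rw [gaussianReal_map_const_mul]
    congr 1
    · simp
    · ext; simp [sq_nonneg]
  have : IsProbabilityMeasure ((gaussianReal 0 1).map (fun x => σ * x)) := by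
    rw [hs]; infer_instance
  rw [h, Measure.pi_map_pi (μ := fun _ => gaussianReal 0 1) (f := fun _ x => σ * x)
    (fun i => by fun_prop), hs]

end GaussianTails
section SubsetSums

variable {ι : Type*} [Fintype ι] [DecidableEq ι]

lemma sum_erase_empty_pow_card_le {x : ℝ} (hx : 0 ≤ x) (hx1 : Fintype.card ι * x ≤ 1) :
    ∑ D ∈ (univ : Finset (Finset ι)).erase ∅, x ^ #D ≤ 2 * (Fintype.card ι * x) := by
  have h := Fintype.sum_pow_mul_eq_add_pow ι x 1
  simp only [one_pow, mul_one] at h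
  rw [← Finset.add_sum_erase _ _ (Finset.mem_univ (∅ : Finset ι))] at h
  simp only [card_empty, pow_zero] at h
  have h1 : (x + 1) ^ Fintype.card ι ≤ Real.exp (Fintype.card ι * x) := by
    rw [Real.exp_nat_mul]
    exact pow_le_pow_left₀ (by positivity) (Real.add_one_le_exp x) _
  have h0 : 0 ≤ (Fintype.card ι : ℝ) * x := by positivity
  have h2 := Real.abs_exp_sub_one_le (x := Fintype.card ι * x) (by rwa [abs_of_nonneg h0])
  rw [abs_of_nonneg h0] at h2
  linarith [le_abs_self (Real.exp (Fintype.card ι * x) - 1)]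

lemma sum_erase_pow_card_symmDiff_le (A : Finset ι) {x : ℝ} (hx : 0 ≤ x)
    (hx1 : Fintype.card ι * x ≤ 1) :
    ∑ J ∈ (univ : Finset (Finset ι)).erase A, x ^ #(symmDiff J A) ≤ 2 * (Fintype.card ι * x) := by
  refine le_of_eq_of_le ?_ (sum_erase_empty_pow_card_le (ι := ι) hx hx1)
  refine Finset.sum_nbij' (fun J => symmDiff J A) (fun D => symmDiff D A) ?_ ?_ ?_ ?_ ?_
  · intro J hJ
    simpa using hJ
  · intro D hD
    simp only [mem_erase, mem_univ, and_true] at hD ⊢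
    intro h
    exact hD (by simpa using h)
  · intro J _; simp
  · intro D _; simp
  · intro J _; rfl

end SubsetSums

section Choose

lemma choose_le_mul_choose_succ {p s : ℕ} (h : s + 1 ≤ p) :
    p.choose s ≤ p * p.choose (s + 1) := by
  have h1 := Nat.choose_succ_right_eq p s
  calc p.choose s ≤ p.choose s * (p - s) := Nat.le_mul_of_pos_right _ (by omega)
    _ = p.choose (s + 1) * (s + 1) := h1.symm
    _ ≤ p.choose (s + 1) * p := Nat.mul_le_mul_left _ h
    _ = _ := mul_comm _ _

lemma choose_succ_le_mul_choose (p s : ℕ) : p.choose (s + 1) ≤ p * p.choose s := by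
  have h1 := Nat.choose_succ_right_eq p s
  calc p.choose (s + 1) ≤ p.choose (s + 1) * (s + 1) := Nat.le_mul_of_pos_right _ (by omega)
    _ = p.choose s * (p - s) := h1
    _ ≤ p.choose s * p := Nat.mul_le_mul_left _ (by omega)
    _ = _ := mul_comm _ _

lemma choose_le_pow_mul_choose_add {p s d : ℕ} (h : s + d ≤ p) :
    p.choose s ≤ p ^ d * p.choose (s + d) := by
  induction d with
  | zero => simp
  | succ d ih =>
    calc p.choose s ≤ p ^ d * p.choose (s + d) := ih (by omega)
      _ ≤ p ^ d * (p * p.choose (s + d + 1)) :=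
        Nat.mul_le_mul_left _ (choose_le_mul_choose_succ (by omega))
      _ = _ := by rw [pow_succ, mul_assoc]; rfl

lemma choose_add_le_pow_mul_choose (p s d : ℕ) :
    p.choose (s + d) ≤ p ^ d * p.choose s := by
  induction d with
  | zero => simp
  | succ d ih =>
    calc p.choose (s + d + 1) ≤ p * p.choose (s + d) := choose_succ_le_mul_choose _ _
      _ ≤ p * (p ^ d * p.choose s) := Nat.mul_le_mul_left _ ih
      _ = _ := by ring

lemma choose_le_pow_mul_choose {p s k r : ℕ} (hp : 1 ≤ p) (hk : k ≤ p)
    (h1 : k ≤ s + r) (h2 : s ≤ k + r) : p.choose s ≤ p ^ r * p.choose k := by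
  rcases le_total s k with h | h
  · obtain ⟨d, rfl⟩ := Nat.exists_eq_add_of_le h
    exact (choose_le_pow_mul_choose_add hk).trans
      (Nat.mul_le_mul_right _ (Nat.pow_le_pow_right hp (by omega)))
  · obtain ⟨d, rfl⟩ := Nat.exists_eq_add_of_le h
    exact (choose_add_le_pow_mul_choose _ _ _).trans
      (Nat.mul_le_mul_right _ (Nat.pow_le_pow_right hp (by omega)))

end Choose

section ColumnSpan

variable {ι E : Type*} [NormedAddCommGroup E] [InnerProductSpace ℝ E]

/-- The span of the columns `x j`, `j ∈ J`. -/
def colSpan (x : ι → E) (J : Finset ι) : Submodule ℝ E := Submodule.span ℝ (x '' J)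

lemma mem_colSpan [Fintype ι] [DecidableEq ι] {x : ι → E} {J : Finset ι} {v : E} :
    v ∈ colSpan x J ↔ ∃ b : ι → ℝ, (∀ j ∉ J, b j = 0) ∧ v = ∑ j, b j • x j := by
  rw [colSpan, Submodule.mem_span_image_finset_iff_exists_fun']
  constructor
  · rintro ⟨c, rfl⟩
    refine ⟨fun j => if j ∈ J then c j else 0, fun j hj => if_neg hj, ?_⟩
    simp [ite_smul]
  · rintro ⟨b, hb, rfl⟩
    refine ⟨b, Finset.sum_subset (Finset.subset_univ J) fun j _ hj => by rw [hb j hj, zero_smul]⟩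

lemma col_mem_colSpan (x : ι → E) {J : Finset ι} {j : ι} (hj : j ∈ J) : x j ∈ colSpan x J :=
  Submodule.subset_span ⟨j, hj, rfl⟩

lemma colSpan_mono (x : ι → E) {A B : Finset ι} (h : A ⊆ B) : colSpan x A ≤ colSpan x B :=
  Submodule.span_mono (Set.image_mono (by exact_mod_cast h))

variable [FiniteDimensional ℝ E]

lemma norm_sub_starProjection_sq (K : Submodule ℝ E) (v : E) :
    ‖v - K.starProjection v‖ ^ 2 = ‖v‖ ^ 2 - ‖K.starProjection v‖ ^ 2 := by
  have h := Submodule.norm_sq_eq_add_norm_sq_starProjection v K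
  rw [Submodule.starProjection_orthogonal_val] at h
  linarith

lemma norm_starProjection_sq_mono {K L : Submodule ℝ E} (h : K ≤ L) (v : E) :
    ‖K.starProjection v‖ ^ 2 ≤ ‖L.starProjection v‖ ^ 2 := by
  have h1 : K.starProjection (L.starProjection v) = K.starProjection v :=
    congrArg (fun f : E →L[ℝ] E => f v) (Submodule.starProjection_comp_starProjection_of_le h)
  rw [← h1]
  gcongr
  exact K.norm_starProjection_apply_le _

lemma norm_starProjection_sq_sub {K L : Submodule ℝ E} (h : K ≤ L) (v : E) :
    ‖L.starProjection v‖ ^ 2 - ‖K.starProjection v‖ ^ 2 = ‖(Kᗮ ⊓ L).starProjection v‖ ^ 2 := by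
  have h1 : K.starProjection (L.starProjection v) = K.starProjection v :=
    congrArg (fun f : E →L[ℝ] E => f v) (Submodule.starProjection_comp_starProjection_of_le h)
  have h2 : (Kᗮ ⊓ L).starProjection v = L.starProjection v - K.starProjection v := by
    refine Submodule.eq_starProjection_of_mem_orthogonal (K := Kᗮ ⊓ L) ⟨?_, ?_⟩ ?_
    · rw [← h1]; exact K.sub_starProjection_mem_orthogonal _
    · exact sub_mem (L.starProjection_apply_mem v) (h (K.starProjection_apply_mem v))
    · have : v - (L.starProjection v - K.starProjection v)
          = (v - L.starProjection v) + K.starProjection v := by abel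
      rw [this]
      refine add_mem ?_ ?_
      · exact Submodule.orthogonal_le inf_le_right (L.sub_starProjection_mem_orthogonal v)
      · rw [Submodule.mem_orthogonal]
        intro u hu
        rw [real_inner_comm]
        exact hu.1 _ (K.starProjection_apply_mem v)
  have h3 := norm_sub_starProjection_sq K (L.starProjection v)
  rw [h1] at h3
  rw [h2, h3]

lemma finrank_orthogonal_inf_colSpan_le [DecidableEq ι] (x : ι → E) (A D : Finset ι) :
    Module.finrank ℝ ((colSpan x A)ᗮ ⊓ colSpan x (A ∪ D) : Submodule ℝ E) ≤ #D := by
  have h := Submodule.finrank_add_inf_finrank_orthogonal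
    (colSpan_mono x (Finset.subset_union_left (s₁ := A) (s₂ := D)))
  have h2 : colSpan x (A ∪ D) = colSpan x A ⊔ colSpan x D := by
    simp [colSpan, Set.image_union, Submodule.span_union]
  have h3 : Module.finrank ℝ (colSpan x (A ∪ D)) ≤
      Module.finrank ℝ (colSpan x A) + Module.finrank ℝ (colSpan x D) := by
    rw [h2]; exact Submodule.finrank_add_le_finrank_add_finrank _ _
  have h4 : Module.finrank ℝ (colSpan x D) ≤ #D := by
    have := finrank_span_finset_le_card (R := ℝ) (D.image x)
    rw [Finset.coe_image] at this
    exact this.trans Finset.card_image_le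
  omega

end ColumnSpan
section ResidualBounds

variable {ι E : Type*} [Fintype ι] [DecidableEq ι] [NormedAddCommGroup E] [InnerProductSpace ℝ E]
  [FiniteDimensional ℝ E]

lemma residual_of_mem {K : Submodule ℝ E} {f : E} (hf : f ∈ K) (ζ : E) :
    ‖f + ζ - K.starProjection (f + ζ)‖ ^ 2 = ‖ζ‖ ^ 2 - ‖K.starProjection ζ‖ ^ 2 := by
  rw [map_add, Submodule.starProjection_eq_self_iff.2 hf, add_sub_add_left_eq_sub,
    norm_sub_starProjection_sq]

lemma residual_ge_of_le {K L : Submodule ℝ E} (h : K ≤ L) {f : E} (hf : f ∈ L) (ζ : E) :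
    ‖ζ‖ ^ 2 - ‖L.starProjection ζ‖ ^ 2 ≤ ‖f + ζ - K.starProjection (f + ζ)‖ ^ 2 := by
  rw [← residual_of_mem hf, norm_sub_starProjection_sq, norm_sub_starProjection_sq]
  linarith [norm_starProjection_sq_mono h (f + ζ)]

lemma residual_ge_signal {K L : Submodule ℝ E} (h : K ≤ L) (f ζ : E) :
    ‖f - K.starProjection f‖ ^ 2 + 2 * inner ℝ (f - K.starProjection f) ζ
      + (‖ζ‖ ^ 2 - ‖L.starProjection ζ‖ ^ 2) ≤ ‖f + ζ - K.starProjection (f + ζ)‖ ^ 2 := by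
  have h1 : f + ζ - K.starProjection (f + ζ)
      = (f - K.starProjection f) + (ζ - K.starProjection ζ) := by
    rw [map_add]; abel
  have h2 : inner ℝ (f - K.starProjection f) (K.starProjection ζ) = 0 :=
    K.starProjection_inner_eq_zero _ _ (K.starProjection_apply_mem ζ)
  rw [h1, norm_add_sq_real, inner_sub_right, h2, norm_sub_starProjection_sq K ζ]
  linarith [norm_starProjection_sq_mono h ζ]

lemma signal_lower_bound {x : ι → E} {A J : Finset ι} {β : ι → ℝ} {κ b₀ s : ℝ}
    (hβ : ∀ j ∉ A, β j = 0)
    (hRE : ∀ (J : Finset ι) (b : ι → ℝ), (#J : ℝ) ≤ s → (∀ j ∉ J, b j = 0) →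
      κ ^ 2 * ∑ j, b j ^ 2 ≤ ‖∑ j, b j • x j‖ ^ 2)
    (hb₀ : 0 ≤ b₀) (hmin : ∀ j ∈ A, b₀ ≤ |β j|) (hJ : (#(J ∪ A) : ℝ) ≤ s) :
    κ ^ 2 * (#(A \ J) * b₀ ^ 2)
      ≤ ‖∑ j, β j • x j - (colSpan x J).starProjection (∑ j, β j • x j)‖ ^ 2 := by
  obtain ⟨b, hb, hbx⟩ := mem_colSpan.1
    ((colSpan x J).starProjection_apply_mem (∑ j, β j • x j))
  rw [hbx, ← Finset.sum_sub_distrib]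
  simp_rw [← sub_smul]
  refine le_trans ?_ (hRE (J ∪ A) (fun j => β j - b j) hJ ?_)
  · gcongr
    calc (#(A \ J) : ℝ) * b₀ ^ 2 = ∑ j ∈ A \ J, b₀ ^ 2 := by simp
      _ ≤ ∑ j ∈ A \ J, (β j - b j) ^ 2 := by
        refine Finset.sum_le_sum fun j hj => ?_
        rw [Finset.mem_sdiff] at hj
        rw [hb j hj.2, sub_zero, ← sq_abs (β j)]
        gcongr
        exact hmin j hj.1
      _ ≤ _ := Finset.sum_le_univ_sum_of_nonneg fun j => sq_nonneg _
  · intro j hj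
    rw [Finset.mem_union, not_or] at hj
    rw [hβ j hj.2, hb j hj.1, sub_zero]

lemma posterior_exponent_bound {x : ι → E} {A : Finset ι} {β : ι → ℝ} {ζ : E}
    {σ ε c L lam κ : ℝ} (hσ : 0 < σ) (hε : 0 < ε) (hc : 0 ≤ c) (hL : 0 ≤ L) (hκ : 0 < κ)
    (hlam : ((1 + ε) * (23 + 5 * c) + 1) / ε * L = lam)
    (hβ : ∀ j ∉ A, β j = 0)
    (hRE : ∀ (J : Finset ι) (b : ι → ℝ), (#J : ℝ) ≤ (2 + ε) * #A → (∀ j ∉ J, b j = 0) →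
      κ ^ 2 * ∑ j, b j ^ 2 ≤ ‖∑ j, b j • x j‖ ^ 2)
    (hmin : ∀ j ∈ A, 3 * σ * √lam / κ ≤ |β j|)
    (hcross : ∀ J, -(σ * (√(2 * ((c + 3) * #(symmDiff J A) * L)) *
      ‖∑ j, β j • x j - (colSpan x J).starProjection (∑ j, β j • x j)‖)) ≤
      inner ℝ (∑ j, β j • x j - (colSpan x J).starProjection (∑ j, β j • x j)) ζ)
    (hchi : ∀ D, ‖(colSpan x (A ∪ D)).starProjection ζ‖ ^ 2
      - ‖(colSpan x A).starProjection ζ‖ ^ 2 ≤ σ ^ 2 * ((14 + 4 * c) * #D * L))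
    (J : Finset ι) :
    (8 + c) * #(symmDiff J A) * L ≤ lam * (#J - #A)
      + (‖∑ j, β j • x j + ζ - (colSpan x J).starProjection (∑ j, β j • x j + ζ)‖ ^ 2
        - ‖∑ j, β j • x j + ζ - (colSpan x A).starProjection (∑ j, β j • x j + ζ)‖ ^ 2)
          / (2 * σ ^ 2) := by
  set f := ∑ j, β j • x j with hf
  have hfA : f ∈ colSpan x A := mem_colSpan.2 ⟨β, hβ, hf⟩
  have hJU : colSpan x J ≤ colSpan x (A ∪ J \ A) :=
    colSpan_mono x (by rw [Finset.union_sdiff_self_eq_union]; exact Finset.subset_union_right)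
  have hAU : colSpan x A ≤ colSpan x (A ∪ J \ A) := colSpan_mono x Finset.subset_union_left
  rw [residual_of_mem hfA]
  have hchiJ := hchi (J \ A)
  have hcrossJ := hcross J
  have hk : #J + #(A \ J) = #A + #(J \ A) := by
    have h1 := Finset.card_sdiff_add_card J A
    have h2 := Finset.card_sdiff_add_card A J
    rw [Finset.union_comm] at h2
    omega
  have hr : #(symmDiff J A) = #(J \ A) + #(A \ J) := by
    rw [symmDiff, Finset.sup_eq_union, Finset.card_union_of_disjoint]
    exact disjoint_sdiff_sdiff
  have heJ : #(J \ A) ≤ #J := Finset.card_le_card Finset.sdiff_subset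
  have hmA : #(A \ J) ≤ #A := Finset.card_le_card Finset.sdiff_subset
  have hunion : #(J ∪ A) = #A + #(J \ A) := by
    have h1 := Finset.card_sdiff_add_card J A
    omega
  have hk' : (#J : ℝ) + #(A \ J) = #A + #(J \ A) := by exact_mod_cast hk
  have hr' : (#(symmDiff J A) : ℝ) = #(J \ A) + #(A \ J) := by exact_mod_cast hr
  have heJ' : (#(J \ A) : ℝ) ≤ #J := by exact_mod_cast heJ
  have hmA' : (#(A \ J) : ℝ) ≤ #A := by exact_mod_cast hmA
  have hlamL : (23 + 5 * c) * L ≤ lam := by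
    rw [← hlam]
    gcongr
    rw [le_div_iff₀ hε]
    nlinarith
  have hlam0 : 0 ≤ lam := le_trans (by positivity) hlamL
  have hσ2 : 0 < σ ^ 2 := by positivity
  rcases le_or_gt (#J : ℝ) ((1 + ε) * #A) with hcase | hcase
  · have hsig := signal_lower_bound hβ hRE (by positivity) hmin (J := J)
      (by rw [hunion]; push_cast; linarith)
    have hres := residual_ge_signal hJU f ζ
    rw [← hf] at hsig
    set a := ‖f - (colSpan x J).starProjection f‖ with ha
    set T := √(2 * ((c + 3) * #(symmDiff J A) * L)) with hT
    have hT2 : T ^ 2 = 2 * ((c + 3) * #(symmDiff J A) * L) := Real.sq_sqrt (by positivity)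
    have hsig' : 9 * lam * #(A \ J) * σ ^ 2 ≤ a ^ 2 := by
      refine le_trans (le_of_eq ?_) hsig
      rw [div_pow, mul_pow, Real.sq_sqrt hlam0]
      field_simp
      ring
    have hyoung : a ^ 2 / 2 - 2 * T ^ 2 * σ ^ 2 ≤ a ^ 2 - 2 * (σ * (T * a)) := by
      nlinarith [sq_nonneg (a - 2 * (T * σ))]
    rw [← sub_le_iff_le_add', le_div_iff₀ (by positivity)]
    have hfin : ((8 + c) * #(symmDiff J A) * L - lam * (#J - #A)) * 2
        ≤ 9 * lam * #(A \ J) / 2 - 2 * T ^ 2 - (14 + 4 * c) * #(J \ A) * L := by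
      rw [hT2, hr', show (#J : ℝ) - #A = #(J \ A) - #(A \ J) by linarith]
      have e0 : (0 : ℝ) ≤ #(J \ A) := by positivity
      have m0 : (0 : ℝ) ≤ #(A \ J) := by positivity
      have h1 := mul_le_mul_of_nonneg_right hlamL e0
      have h2 := mul_le_mul_of_nonneg_right hlamL m0
      have h3 : 0 ≤ c * L * #(J \ A) := by positivity
      have h4 : 0 ≤ c * L * #(A \ J) := by positivity
      have h5 : 0 ≤ L * #(J \ A) := by positivity
      have h6 : 0 ≤ L * #(A \ J) := by positivity
      linarith
    have := mul_le_mul_of_nonneg_right hfin hσ2.le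
    linarith
  · have hres := residual_ge_of_le hJU (hAU hfA) ζ
    rw [← sub_le_iff_le_add', le_div_iff₀ (by positivity)]
    have hfin : ((8 + c) * #(symmDiff J A) * L - lam * (#J - #A)) * 2
        ≤ - ((14 + 4 * c) * #(J \ A) * L) := by
      have hkA : (#A : ℝ) ≤ #J := by
        refine le_trans ?_ hcase.le
        nlinarith [(Nat.cast_nonneg #A : (0 : ℝ) ≤ #A)]
      have hgap : (23 + 5 * c) * #J * L ≤ lam * (#J - #A) := by
        have h1 : (#J : ℝ) ≤ (1 + ε) / ε * (#J - #A) := by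
          rw [div_mul_eq_mul_div, le_div_iff₀ hε]
          linarith
        have h2 : (1 + ε) / ε * (23 + 5 * c) * L ≤ lam := by
          rw [← hlam, div_mul_eq_mul_div]
          gcongr
          linarith
        calc (23 + 5 * c) * #J * L ≤ (23 + 5 * c) * ((1 + ε) / ε * (#J - #A)) * L := by gcongr
          _ = (1 + ε) / ε * (23 + 5 * c) * L * (#J - #A) := by ring
          _ ≤ _ := by
            refine mul_le_mul_of_nonneg_right h2 (by linarith)
      have hr2 : (#(symmDiff J A) : ℝ) ≤ 2 * #J := by linarith
      have h1 : (8 + c) * #(symmDiff J A) * L ≤ (8 + c) * (2 * #J) * L := by gcongr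
      have h2 : (14 + 4 * c) * #(J \ A) * L ≤ (14 + 4 * c) * #J * L := by gcongr
      have h3 : 0 ≤ c * #J * L := by positivity
      have h4 : 0 ≤ #J * L := by positivity
      linarith
    have := mul_le_mul_of_nonneg_right hfin hσ2.le
    linarith

end ResidualBounds
section CoordinateError

variable {ι E : Type*} [Fintype ι] [DecidableEq ι] [NormedAddCommGroup E] [InnerProductSpace ℝ E]
  [FiniteDimensional ℝ E]

/-- The component of the column `x j` orthogonal to the other columns indexed by `A`. -/
noncomputable def colResidual (x : ι → E) (A : Finset ι) (j : ι) : E :=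
  x j - (colSpan x (A.erase j)).starProjection (x j)

lemma inner_colResidual_sum {x : ι → E} {A : Finset ι} {j : ι} {d : ι → ℝ}
    (hd : ∀ i ∉ A, d i = 0) :
    inner ℝ (colResidual x A j) (∑ i, d i • x i) = d j * ‖colResidual x A j‖ ^ 2 := by
  have horth : ∀ v ∈ colSpan x (A.erase j), inner ℝ (colResidual x A j) v = 0 := fun v hv =>
    Submodule.starProjection_inner_eq_zero _ _ hv
  rw [inner_sum, Finset.sum_eq_single j]
  · have h1 : x j = colResidual x A j + (colSpan x (A.erase j)).starProjection (x j) := by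
      simp [colResidual]
    have h2 := congrArg (inner ℝ (colResidual x A j)) h1
    rw [inner_add_right, horth _ (Submodule.starProjection_apply_mem _ _), add_zero,
      real_inner_self_eq_norm_sq] at h2
    rw [inner_smul_right, h2]
  · intro i _ hij
    by_cases hi : i ∈ A
    · rw [inner_smul_right, horth _ (col_mem_colSpan x (Finset.mem_erase.2 ⟨hij, hi⟩)), mul_zero]
    · rw [hd i hi, zero_smul, inner_zero_right]
  · simp

lemma colResidual_eq_sum (x : ι → E) {A : Finset ι} {j : ι} (hj : j ∈ A) :
    ∃ b : ι → ℝ, (∀ i ∉ A, b i = 0) ∧ b j = 1 ∧ colResidual x A j = ∑ i, b i • x i := by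
  obtain ⟨b, hb, hbx⟩ := mem_colSpan.1
    ((colSpan x (A.erase j)).starProjection_apply_mem (x j))
  refine ⟨Pi.single j 1 - b, ?_, ?_, ?_⟩
  · intro i hi
    have hij : i ≠ j := fun h => hi (h ▸ hj)
    simp [hij, hb i (fun h => hi (Finset.mem_of_mem_erase h))]
  · simp [hb j (Finset.notMem_erase j A)]
  · simp only [Pi.sub_apply, sub_smul, Finset.sum_sub_distrib, colResidual, hbx]
    simp [Pi.single_apply, ite_smul]

lemma le_norm_colResidual {x : ι → E} {A : Finset ι} {κ : ℝ}
    (hRE : ∀ b : ι → ℝ, (∀ j ∉ A, b j = 0) → κ ^ 2 * ∑ j, b j ^ 2 ≤ ‖∑ j, b j • x j‖ ^ 2)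
    {j : ι} (hj : j ∈ A) : κ ≤ ‖colResidual x A j‖ := by
  obtain ⟨b, hb, hbj, hbx⟩ := colResidual_eq_sum x hj
  rw [hbx]
  refine le_of_sq_le_sq (α := ℝ) ?_ (norm_nonneg _)
  refine le_trans ?_ (hRE b hb)
  have h1 : b j ^ 2 ≤ ∑ j, b j ^ 2 :=
    Finset.single_le_sum (f := fun j => b j ^ 2) (fun _ _ => sq_nonneg _) (Finset.mem_univ j)
  rw [hbj, one_pow] at h1
  exact le_mul_of_one_le_right (sq_nonneg κ) h1

lemma abs_coord_sub_le {x : ι → E} {A : Finset ι} {b β : ι → ℝ} {ζ : E} {κ τ : ℝ}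
    (hκ : 0 < κ) (hτ : 0 ≤ τ)
    (hRE : ∀ b : ι → ℝ, (∀ j ∉ A, b j = 0) → κ ^ 2 * ∑ j, b j ^ 2 ≤ ‖∑ j, b j • x j‖ ^ 2)
    (hb : ∀ j ∉ A, b j = 0) (hβ : ∀ j ∉ A, β j = 0)
    (hfit : ∑ j, b j • x j = (colSpan x A).starProjection (∑ j, β j • x j + ζ)) {j : ι}
    (hζ : |inner ℝ (colResidual x A j) ζ| ≤ τ * ‖colResidual x A j‖) :
    |b j - β j| ≤ τ / κ := by
  by_cases hj : j ∈ A
  swap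
  · rw [hb j hj, hβ j hj, sub_zero, abs_zero]
    positivity
  have hw := le_norm_colResidual hRE hj
  have hw0 : 0 < ‖colResidual x A j‖ := hκ.trans_le hw
  have hwA : colResidual x A j ∈ colSpan x A := by
    obtain ⟨d, hd, -, hdx⟩ := colResidual_eq_sum x hj
    exact mem_colSpan.2 ⟨d, hd, hdx⟩
  have hβA : ∑ j, β j • x j ∈ colSpan x A := mem_colSpan.2 ⟨β, hβ, rfl⟩
  have hdiff : ∑ i, (b i - β i) • x i = (colSpan x A).starProjection ζ := by
    simp_rw [sub_smul, Finset.sum_sub_distrib]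
    rw [hfit, map_add, Submodule.starProjection_eq_self_iff.2 hβA, add_sub_cancel_left]
  have h1 := inner_colResidual_sum (x := x) (A := A) (j := j) (d := fun i => b i - β i)
    (fun i hi => by rw [hb i hi, hβ i hi, sub_zero])
  rw [hdiff, ← Submodule.inner_starProjection_left_eq_right,
    Submodule.starProjection_eq_self_iff.2 hwA] at h1
  rw [h1, abs_mul, abs_of_nonneg (sq_nonneg ‖colResidual x A j‖), pow_two, ← mul_assoc] at hζ
  have h2 := le_of_mul_le_mul_right hζ hw0
  rw [le_div_iff₀ hκ]
  exact (mul_le_mul_of_nonneg_left hw (abs_nonneg _)).trans h2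

end CoordinateError

section NoiseEvents

variable {ι E : Type*} [Fintype ι] [DecidableEq ι] [NormedAddCommGroup E] [InnerProductSpace ℝ E]
  [FiniteDimensional ℝ E] [MeasurableSpace E] [BorelSpace E]

lemma card_mul_exp_neg_le {p : ℕ} (hp : 2 ≤ p) {c : ℝ} :
    p * Real.exp (-((c + 3) * Real.log p)) ≤ Real.exp (-(c * Real.log p)) / 4 := by
  have hp' : (2 : ℝ) ≤ p := by exact_mod_cast hp
  have hp0 : (0 : ℝ) < p := by linarith
  have h : Real.exp (-((c + 3) * Real.log p))
      = Real.exp (-(c * Real.log p)) * ((p : ℝ) ^ 3)⁻¹ := by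
    have h3 : Real.exp (-(3 * Real.log p)) = ((p : ℝ) ^ 3)⁻¹ := by
      rw [Real.exp_neg, show (3 : ℝ) * Real.log p = ((3 : ℕ) : ℝ) * Real.log p by norm_num,
        Real.exp_nat_mul, Real.exp_log hp0]
    rw [← h3, ← Real.exp_add]
    ring_nf
  rw [h]
  have h4 : (p : ℝ) * ((p : ℝ) ^ 3)⁻¹ ≤ 1 / 4 := by
    rw [mul_inv_le_iff₀ (by positivity)]
    nlinarith [mul_le_mul hp' hp' (by norm_num) hp0.le]
  have h5 := mul_le_mul_of_nonneg_left h4 (Real.exp_nonneg (-(c * Real.log p)))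
  linarith

lemma cross_term_tail (hp : 2 ≤ Fintype.card ι) {σ c : ℝ} (hσ : 0 < σ) (hc : 0 ≤ c)
    (A : Finset ι) (g : Finset ι → E) (hg : g A = 0) :
    (stdGaussian E).real {v | ∃ J, inner ℝ (g J) (σ • v) < -(σ *
      (√(2 * ((c + 3) * #(symmDiff J A) * Real.log (Fintype.card ι))) * ‖g J‖))}
      ≤ Real.exp (-(c * Real.log (Fintype.card ι))) / 2 := by
  set p := Fintype.card ι
  have hL : 0 ≤ Real.log p := Real.log_natCast_nonneg _
  have hq := card_mul_exp_neg_le hp (c := c)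
  have hsub : {v : E | ∃ J, inner ℝ (g J) (σ • v) < -(σ *
      (√(2 * ((c + 3) * #(symmDiff J A) * Real.log p)) * ‖g J‖))} ⊆
      ⋃ J ∈ (univ : Finset (Finset ι)).erase A,
        {v | √(2 * ((c + 3) * #(symmDiff J A) * Real.log p)) * ‖-g J‖ < inner ℝ (-g J) v} := by
    rintro v ⟨J, hJ⟩
    have hJA : J ≠ A := by
      rintro rfl
      simp [hg] at hJ
    refine Set.mem_biUnion (Finset.mem_erase.2 ⟨hJA, Finset.mem_univ J⟩) ?_
    rw [Set.mem_ofPred_eq, norm_neg, inner_neg_left]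
    rw [inner_smul_right, ← mul_neg] at hJ
    linarith [lt_of_mul_lt_mul_left hJ hσ.le]
  refine (measureReal_mono hsub (measure_ne_top _ _)).trans
    ((measureReal_biUnion_finset_le _ _).trans ?_)
  have hterm : ∀ J ∈ (univ : Finset (Finset ι)).erase A, (stdGaussian E).real
      {v | √(2 * ((c + 3) * #(symmDiff J A) * Real.log p)) * ‖-g J‖ < inner ℝ (-g J) v}
      ≤ Real.exp (-((c + 3) * Real.log p)) ^ #(symmDiff J A) := by
    intro J _
    refine (stdGaussian_inner_tail (-g J) (Real.sqrt_nonneg _)).trans (le_of_eq ?_)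
    rw [Real.sq_sqrt (by positivity), ← Real.exp_nat_mul]
    congr 1
    ring
  refine (Finset.sum_le_sum hterm).trans
    ((sum_erase_pow_card_symmDiff_le A (Real.exp_nonneg _) ?_).trans ?_)
  · have : Real.exp (-(c * Real.log p)) ≤ 1 := Real.exp_le_one_iff.2 (by
      have := mul_nonneg hc hL; linarith)
    linarith
  · linarith

lemma chi_square_tail (hp : 2 ≤ Fintype.card ι) {σ c : ℝ} (hc : 0 ≤ c)
    (x : ι → E) (A : Finset ι) :
    (stdGaussian E).real {v | ∃ D, σ ^ 2 * ((14 + 4 * c) * #D * Real.log (Fintype.card ι)) <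
      ‖(colSpan x (A ∪ D)).starProjection (σ • v)‖ ^ 2
        - ‖(colSpan x A).starProjection (σ • v)‖ ^ 2}
      ≤ Real.exp (-(c * Real.log (Fintype.card ι))) / 2 := by
  set p := Fintype.card ι
  have hp' : (2 : ℝ) ≤ p := by exact_mod_cast hp
  have hL : 0 ≤ Real.log p := Real.log_natCast_nonneg _
  have hq := card_mul_exp_neg_le hp (c := c)
  let W : Finset ι → Submodule ℝ E := fun D => (colSpan x A)ᗮ ⊓ colSpan x (A ∪ D)
  have hsub : {v : E | ∃ D, σ ^ 2 * ((14 + 4 * c) * #D * Real.log p) <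
      ‖(colSpan x (A ∪ D)).starProjection (σ • v)‖ ^ 2
        - ‖(colSpan x A).starProjection (σ • v)‖ ^ 2} ⊆
      ⋃ D ∈ (univ : Finset (Finset ι)).erase ∅,
        {v | (14 + 4 * c) * #D * Real.log p < ‖(W D).starProjection v‖ ^ 2} := by
    rintro v ⟨D, hD⟩
    have hD0 : D ≠ ∅ := by
      rintro rfl
      simp at hD
    refine Set.mem_biUnion (Finset.mem_erase.2 ⟨hD0, Finset.mem_univ D⟩) ?_
    rw [norm_starProjection_sq_sub (colSpan_mono x Finset.subset_union_left), map_smul, norm_smul,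
      mul_pow, Real.norm_eq_abs, sq_abs] at hD
    exact lt_of_mul_lt_mul_left hD (sq_nonneg σ)
  refine (measureReal_mono hsub (measure_ne_top _ _)).trans
    ((measureReal_biUnion_finset_le _ _).trans ?_)
  have hsqrt : √2 ≤ Real.exp (Real.log p / 2) := by
    rw [Real.exp_half, Real.exp_log (by linarith)]
    exact Real.sqrt_le_sqrt hp'
  have hterm : ∀ D ∈ (univ : Finset (Finset ι)).erase ∅, (stdGaussian E).real
      {v | (14 + 4 * c) * #D * Real.log p < ‖(W D).starProjection v‖ ^ 2}
      ≤ Real.exp (-((c + 3) * Real.log p)) ^ #D := by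
    intro D _
    refine (stdGaussian_norm_starProjection_tail (W D)
      (finrank_orthogonal_inf_colSpan_le x A D) _).trans ?_
    calc √2 ^ #D * Real.exp (-((14 + 4 * c) * #D * Real.log p / 4))
        ≤ Real.exp (Real.log p / 2) ^ #D * Real.exp (-((14 + 4 * c) * #D * Real.log p / 4)) := by
          gcongr
      _ = Real.exp (-((c + 3) * Real.log p)) ^ #D := by
          rw [← Real.exp_nat_mul, ← Real.exp_nat_mul, ← Real.exp_add]
          congr 1
          ring
  refine (Finset.sum_le_sum hterm).trans
    ((sum_erase_empty_pow_card_le (ι := ι) (Real.exp_nonneg _) ?_).trans ?_)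
  · have : Real.exp (-(c * Real.log p)) ≤ 1 := Real.exp_le_one_iff.2 (by
      have := mul_nonneg hc hL; linarith)
    linarith
  · linarith

omit [DecidableEq ι] in
lemma coordinate_tail (hp : 1 ≤ Fintype.card ι) {σ c : ℝ} (hσ : 0 < σ) (hc : 0 ≤ c) (w : ι → E) :
    (stdGaussian E).real {v | ∃ j, σ * √(2 * (c + 1) * Real.log (Fintype.card ι)) * ‖w j‖ <
      |inner ℝ (w j) (σ • v)|} ≤ 2 * Real.exp (-(c * Real.log (Fintype.card ι))) := by
  set p := Fintype.card ι with hpdef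
  have hp' : (0 : ℝ) < p := by exact_mod_cast hp
  have hL : 0 ≤ Real.log p := Real.log_natCast_nonneg _
  set t := √(2 * (c + 1) * Real.log p) with ht
  have hsub : {v : E | ∃ j, σ * t * ‖w j‖ < |inner ℝ (w j) (σ • v)|} ⊆
      ⋃ j ∈ (univ : Finset ι),
        ({v | t * ‖w j‖ < inner ℝ (w j) v} ∪ {v | t * ‖-w j‖ < inner ℝ (-w j) v}) := by
    rintro v ⟨j, hj⟩
    refine Set.mem_biUnion (Finset.mem_univ j) ?_
    rw [inner_smul_right, abs_mul, abs_of_pos hσ, mul_assoc] at hj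
    have := lt_of_mul_lt_mul_left hj hσ.le
    rcases lt_abs.1 this with h | h
    · exact Or.inl h
    · exact Or.inr (by rw [Set.mem_ofPred_eq, norm_neg, inner_neg_left]; exact h)
  have hexp : Real.exp (-(t ^ 2 / 2)) = Real.exp (-(c * Real.log p)) * (p : ℝ)⁻¹ := by
    have hpinv : (p : ℝ)⁻¹ = Real.exp (-Real.log p) := by rw [Real.exp_neg, Real.exp_log hp']
    rw [hpinv, ht, Real.sq_sqrt (by positivity), ← Real.exp_add]
    congr 1
    ring
  refine (measureReal_mono hsub (measure_ne_top _ _)).trans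
    ((measureReal_biUnion_finset_le _ _).trans ?_)
  calc ∑ j, (stdGaussian E).real
        ({v | t * ‖w j‖ < inner ℝ (w j) v} ∪ {v | t * ‖-w j‖ < inner ℝ (-w j) v})
      ≤ ∑ _j : ι, (2 * (Real.exp (-(c * Real.log p)) * (p : ℝ)⁻¹)) := by
        refine Finset.sum_le_sum fun j _ => (measureReal_union_le _ _).trans ?_
        have h1 := stdGaussian_inner_tail (w j) (Real.sqrt_nonneg (2 * (c + 1) * Real.log p))
        have h2 := stdGaussian_inner_tail (-w j) (Real.sqrt_nonneg (2 * (c + 1) * Real.log p))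
        rw [← ht, hexp] at h1 h2
        linarith
    _ = 2 * Real.exp (-(c * Real.log p)) := by
        rw [Finset.sum_const, Finset.card_univ, nsmul_eq_mul, ← hpdef]
        field_simp

end NoiseEvents

section GoodNoise

variable {ι E : Type*} [Fintype ι] [DecidableEq ι] [NormedAddCommGroup E] [InnerProductSpace ℝ E]
  [FiniteDimensional ℝ E]

/-- The noise vector `ζ` is controlled uniformly over all models, with reference model `A` and
signal `f`; `L` plays the role of the logarithm of the number of columns. -/
structure IsTypicalNoise (x : ι → E) (A : Finset ι) (f : E) (σ c L : ℝ) (ζ : E) : Prop where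
  cross : ∀ J, -(σ * (√(2 * ((c + 3) * #(symmDiff J A) * L)) *
    ‖f - (colSpan x J).starProjection f‖)) ≤ inner ℝ (f - (colSpan x J).starProjection f) ζ
  chi : ∀ D, ‖(colSpan x (A ∪ D)).starProjection ζ‖ ^ 2
    - ‖(colSpan x A).starProjection ζ‖ ^ 2 ≤ σ ^ 2 * ((14 + 4 * c) * #D * L)
  norm_sq : ∀ D, ‖(colSpan x D).starProjection ζ‖ ^ 2 ≤ σ ^ 2 * ((14 + 4 * c) * #D * L)
  coord : ∀ j, |inner ℝ (colResidual x A j) ζ|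
    ≤ σ * √(2 * (c + 1) * L) * ‖colResidual x A j‖

lemma one_sub_le_stdGaussian_isTypicalNoise [MeasurableSpace E] [BorelSpace E]
    (hp : 2 ≤ Fintype.card ι) {σ c : ℝ} (hσ : 0 < σ) (hc : 0 ≤ c)
    (x : ι → E) {A : Finset ι} {f : E} (hf : f ∈ colSpan x A) :
    1 - 4 * Real.exp (-(c * Real.log (Fintype.card ι))) ≤ (stdGaussian E).real
      {v | IsTypicalNoise x A f σ c (Real.log (Fintype.card ι)) (σ • v)} := by
  set L := Real.log (Fintype.card ι)
  have h1 := cross_term_tail hp hσ hc A (fun J => f - (colSpan x J).starProjection f)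
    (by rw [Submodule.starProjection_eq_self_iff.2 hf, sub_self])
  have h2 := chi_square_tail hp (σ := σ) hc x A
  have h3 := chi_square_tail hp (σ := σ) hc x ∅
  have h4 := coordinate_tail (by omega) hσ hc (colResidual x A)
  have hexp := Real.exp_nonneg (-(c * L))
  have hbot : colSpan x ∅ = ⊥ := by simp [colSpan]
  simp only [Finset.empty_union, hbot, Submodule.starProjection_bot,
    _root_.zero_apply, norm_zero, ne_eq, OfNat.ofNat_ne_zero, not_false_eq_true, zero_pow,
    sub_zero] at h3
  have hcover : (Set.univ : Set E) ⊆ {v | IsTypicalNoise x A f σ c L (σ • v)} ∪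
      (({v | ∃ J, inner ℝ (f - (colSpan x J).starProjection f) (σ • v) < -(σ *
        (√(2 * ((c + 3) * #(symmDiff J A) * L)) * ‖f - (colSpan x J).starProjection f‖))} ∪
      {v | ∃ D, σ ^ 2 * ((14 + 4 * c) * #D * L) <
        ‖(colSpan x (A ∪ D)).starProjection (σ • v)‖ ^ 2
        - ‖(colSpan x A).starProjection (σ • v)‖ ^ 2}) ∪
      ({v | ∃ D, σ ^ 2 * ((14 + 4 * c) * #D * L) <
        ‖(colSpan x D).starProjection (σ • v)‖ ^ 2} ∪
      {v | ∃ j, σ * √(2 * (c + 1) * L) * ‖colResidual x A j‖ <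
        |inner ℝ (colResidual x A j) (σ • v)|})) := by
    intro v _
    by_contra hv
    simp only [Set.mem_union, Set.mem_ofPred_eq, not_or, not_exists, not_lt] at hv
    exact hv.1 ⟨hv.2.1.1, hv.2.1.2, hv.2.2.1, hv.2.2.2⟩
  have h5 := measureReal_mono (μ := stdGaussian E) hcover (measure_ne_top _ _)
  rw [probReal_univ] at h5
  have h6 := h5.trans ((measureReal_union_le _ _).trans (add_le_add_right
    ((measureReal_union_le _ _).trans (add_le_add (measureReal_union_le _ _)
      (measureReal_union_le _ _))) _))
  linarith

omit [DecidableEq ι] in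
lemma abs_coord_le_of_fit {x : ι → E} {J : Finset ι} {b : ι → ℝ} {f ζ : E} {κ τ : ℝ}
    (hκ : 0 < κ) (hτ : 0 ≤ τ)
    (hRE : ∀ b : ι → ℝ, (∀ j ∉ J, b j = 0) → κ ^ 2 * ∑ j, b j ^ 2 ≤ ‖∑ j, b j • x j‖ ^ 2)
    (hb : ∀ j ∉ J, b j = 0)
    (hfit : ∑ j, b j • x j = (colSpan x J).starProjection (f + ζ))
    (hζ : ‖(colSpan x J).starProjection ζ‖ ^ 2 ≤ τ ^ 2) (j : ι) :
    |b j| ≤ (‖f‖ + τ) / κ := by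
  have h1 : b j ^ 2 ≤ ∑ j, b j ^ 2 :=
    Finset.single_le_sum (f := fun j => b j ^ 2) (fun _ _ => sq_nonneg _) (Finset.mem_univ j)
  have h2 : (κ * |b j|) ^ 2 ≤ ‖∑ j, b j • x j‖ ^ 2 := by
    rw [mul_pow, sq_abs]
    exact (mul_le_mul_of_nonneg_left h1 (sq_nonneg κ)).trans (hRE b hb)
  have h3 := le_of_sq_le_sq (α := ℝ) h2 (norm_nonneg _)
  rw [hfit, map_add] at h3
  have h4 := norm_add_le ((colSpan x J).starProjection f) ((colSpan x J).starProjection ζ)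
  have h5 := (colSpan x J).norm_starProjection_apply_le f
  have h6 := le_of_sq_le_sq (α := ℝ) hζ hτ
  rw [le_div_iff₀ hκ]
  linarith

end GoodNoise

section PosteriorMean

variable {ι : Type*} [Fintype ι] [DecidableEq ι]

lemma model_weight_le {J A : Finset ι} {lam σ c RJ RA : ℝ} (hp : 1 ≤ Fintype.card ι)
    (h : (8 + c) * #(symmDiff J A) * Real.log (Fintype.card ι)
      ≤ lam * (#J - #A) + (RJ - RA) / (2 * σ ^ 2)) :
    ((Fintype.card ι).choose #J : ℝ)⁻¹ * Real.exp (-(lam * #J)) * Real.exp (-RJ / (2 * σ ^ 2))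
      ≤ Real.exp (-((7 + c) * Real.log (Fintype.card ι))) ^ #(symmDiff J A) *
        (((Fintype.card ι).choose #A : ℝ)⁻¹ * Real.exp (-(lam * #A)) *
          Real.exp (-RA / (2 * σ ^ 2))) := by
  set p := Fintype.card ι
  set r := #(symmDiff J A)
  have hp0 : (0 : ℝ) < p := by exact_mod_cast hp
  have hJA : #J ≤ #A + r := by
    refine (Finset.card_le_card (fun i hi => ?_)).trans (Finset.card_union_le A (symmDiff J A))
    by_cases hA : i ∈ A <;> simp [Finset.mem_symmDiff, hA, hi]
  have hAJ : #A ≤ #J + r := by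
    refine (Finset.card_le_card (fun i hi => ?_)).trans (Finset.card_union_le J (symmDiff J A))
    by_cases hJ : i ∈ J <;> simp [Finset.mem_symmDiff, hJ, hi]
  have hcJ : (0 : ℝ) < p.choose #J := by
    exact_mod_cast Nat.choose_pos (Finset.card_le_univ J)
  have hcA : (0 : ℝ) < p.choose #A := by
    exact_mod_cast Nat.choose_pos (Finset.card_le_univ A)
  have h1 : (p.choose #A : ℝ) ≤ p ^ r * p.choose #J := by
    exact_mod_cast choose_le_pow_mul_choose hp (Finset.card_le_univ J) hJA hAJ
  have h2 : (p.choose #J : ℝ)⁻¹ ≤ p ^ r * (p.choose #A : ℝ)⁻¹ := by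
    rw [inv_le_iff_one_le_mul₀ hcJ, mul_right_comm, ← div_eq_mul_inv, le_div_iff₀ hcA, one_mul]
    exact h1
  have h3 : Real.exp (-(lam * #J) + -RJ / (2 * σ ^ 2)) ≤
      Real.exp (-((8 + c) * r * Real.log p)) *
        Real.exp (-(lam * #A) + -RA / (2 * σ ^ 2)) := by
    rw [← Real.exp_add, Real.exp_le_exp]
    have e : (RJ - RA) / (2 * σ ^ 2) = -RA / (2 * σ ^ 2) - -RJ / (2 * σ ^ 2) := by ring
    rw [e] at h
    linarith
  have h4 : Real.exp (-((7 + c) * Real.log p)) ^ r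
      = p ^ r * Real.exp (-((8 + c) * r * Real.log p)) := by
    rw [← Real.exp_nat_mul]
    conv_rhs => rw [← Real.exp_log hp0, ← Real.exp_nat_mul, Real.exp_log hp0, ← Real.exp_add]
    congr 1
    ring
  rw [mul_assoc, mul_assoc, ← Real.exp_add, ← Real.exp_add, h4]
  calc _ ≤ (p ^ r * (p.choose #A : ℝ)⁻¹) * (Real.exp (-((8 + c) * r * Real.log p)) *
        Real.exp (-(lam * #A) + -RA / (2 * σ ^ 2))) := by gcongr
    _ = _ := by ring

lemma abs_weighted_mean_sub_le {W a : Finset ι → ℝ} {A : Finset ι} {q t e M : ℝ}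
    (hq : 0 ≤ q) (hq1 : Fintype.card ι * q ≤ 1) (hM : 0 ≤ M)
    (hW : ∀ J, 0 ≤ W J) (hWA : 0 < W A) (hWq : ∀ J, W J ≤ q ^ #(symmDiff J A) * W A)
    (he : |a A - t| ≤ e) (ha : ∀ J, W J ≠ 0 → |a J - t| ≤ M) :
    |∑ J, W J / (∑ J', W J') * a J - t| ≤ e + 2 * (Fintype.card ι * q) * M := by
  set S := ∑ J', W J'
  have hAS : W A ≤ S := Finset.single_le_sum (fun J _ => hW J) (Finset.mem_univ A)
  have hS : 0 < S := hWA.trans_le hAS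
  have h1 : ∑ J, W J / S * a J - t = ∑ J, W J / S * (a J - t) := by
    simp_rw [mul_sub, Finset.sum_sub_distrib, ← Finset.sum_mul, ← Finset.sum_div]
    rw [div_self hS.ne', one_mul]
  rw [h1, ← Finset.add_sum_erase _ _ (Finset.mem_univ A)]
  refine (abs_add_le _ _).trans (add_le_add ?_ ?_)
  · rw [abs_mul, abs_of_nonneg (by positivity)]
    exact (mul_le_of_le_one_left (abs_nonneg _) ((div_le_one hS).2 hAS)).trans he
  · refine (Finset.abs_sum_le_sum_abs _ _).trans ?_
    calc ∑ J ∈ univ.erase A, |W J / S * (a J - t)|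
        ≤ ∑ J ∈ univ.erase A, q ^ #(symmDiff J A) * M := by
          refine Finset.sum_le_sum fun J _ => ?_
          rw [abs_mul, abs_of_nonneg (div_nonneg (hW J) hS.le)]
          rcases eq_or_ne (W J) 0 with h0 | h0
          · rw [h0, zero_div, zero_mul]
            positivity
          · refine mul_le_mul ?_ (ha J h0) (abs_nonneg _) (by positivity)
            rw [div_le_iff₀ hS]
            exact (hWq J).trans (mul_le_mul_of_nonneg_left hAS (by positivity))
      _ ≤ 2 * (Fintype.card ι * q) * M := by
          rw [← Finset.sum_mul]
          exact mul_le_mul_of_nonneg_right (sum_erase_pow_card_symmDiff_le A hq hq1) hM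

end PosteriorMean

section PosteriorMeanError

variable {ι E : Type*} [Fintype ι] [DecidableEq ι] [NormedAddCommGroup E] [InnerProductSpace ℝ E]
  [FiniteDimensional ℝ E]

lemma IsTypicalNoise.abs_posterior_mean_sub_le {x : ι → E} {A : Finset ι} {β : ι → ℝ} {ζ : E}
    {σ ε c lam κ κA κb m : ℝ} {sbar : ℕ} {W : Finset ι → ℝ} {b : Finset ι → ι → ℝ}
    (hζ : IsTypicalNoise x A (∑ j, β j • x j) σ c (Real.log (Fintype.card ι)) ζ)
    (hp : 2 ≤ Fintype.card ι) (hσ : 0 < σ) (hε : 0 < ε) (hc : 0 ≤ c)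
    (hκ : 0 < κ) (hκA : 0 < κA) (hκb : 0 < κb)
    (hlam : ((1 + ε) * (23 + 5 * c) + 1) / ε * Real.log (Fintype.card ι) = lam)
    (hβ : ∀ j ∉ A, β j = 0) (hA : #A ≤ sbar)
    (hRE : ∀ (J : Finset ι) (b : ι → ℝ), (#J : ℝ) ≤ (2 + ε) * #A → (∀ j ∉ J, b j = 0) →
      κ ^ 2 * ∑ j, b j ^ 2 ≤ ‖∑ j, b j • x j‖ ^ 2)
    (hREA : ∀ b : ι → ℝ, (∀ j ∉ A, b j = 0) →
      κA ^ 2 * ∑ j, b j ^ 2 ≤ ‖∑ j, b j • x j‖ ^ 2)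
    (hREb : ∀ (J : Finset ι) (b : ι → ℝ), #J ≤ sbar → (∀ j ∉ J, b j = 0) →
      κb ^ 2 * ∑ j, b j ^ 2 ≤ ‖∑ j, b j • x j‖ ^ 2)
    (hmin : ∀ j ∈ A, 3 * σ * √lam / κ ≤ |β j|)
    (hW : ∀ J, W J = if #J ≤ sbar then
      ((Fintype.card ι).choose #J : ℝ)⁻¹ * Real.exp (-(lam * #J)) *
        Real.exp (-‖∑ j, β j • x j + ζ - (colSpan x J).starProjection (∑ j, β j • x j + ζ)‖ ^ 2
          / (2 * σ ^ 2)) else 0)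
    (hb : ∀ J, ∀ j ∉ J, b J j = 0)
    (hfit : ∀ J, ∑ j, b J j • x j = (colSpan x J).starProjection (∑ j, β j • x j + ζ))
    {j : ι} (hm : |β j| ≤ m) :
    |∑ J, W J / (∑ J', W J') * b J j - β j| ≤
      σ * √(2 * (c + 1) * Real.log (Fintype.card ι)) / κA +
        2 * (Fintype.card ι * Real.exp (-((7 + c) * Real.log (Fintype.card ι)))) *
          (Fintype.card ι * ((‖∑ j, β j • x j‖ +
            σ * √((14 + 4 * c) * Real.log (Fintype.card ι))) / κb + m)) := by
  set p := Fintype.card ι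
  set L := Real.log p with hLdef
  set f := ∑ j, β j • x j with hf
  have hp' : (2 : ℝ) ≤ p := by exact_mod_cast hp
  have hp0 : (0 : ℝ) < p := by linarith
  have hL : 0 ≤ L := Real.log_natCast_nonneg _
  have hm0 : 0 ≤ m := (abs_nonneg _).trans hm
  have hWnn : ∀ J, 0 ≤ W J := fun J => by
    rw [hW]
    split_ifs <;> positivity
  have hWA : 0 < W A := by
    have := Nat.choose_pos (Finset.card_le_univ A)
    rw [hW, if_pos hA]
    positivity
  have hq1 : (p : ℝ) * Real.exp (-((7 + c) * L)) ≤ 1 := by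
    have h1 : Real.exp (-((7 + c) * L)) ≤ Real.exp (-L) := by
      rw [Real.exp_le_exp]
      nlinarith [mul_nonneg hc hL]
    rw [Real.exp_neg L, Real.exp_log hp0] at h1
    calc (p : ℝ) * Real.exp (-((7 + c) * L)) ≤ p * (p : ℝ)⁻¹ := by gcongr
      _ = 1 := mul_inv_cancel₀ hp0.ne'
  refine abs_weighted_mean_sub_le (A := A) (Real.exp_nonneg _) hq1 (by positivity) hWnn hWA ?_
    ?_ ?_
  · intro J
    rw [hW J, hW A, if_pos hA]
    split_ifs with hJ
    · exact model_weight_le (by omega) (posterior_exponent_bound hσ hε hc hL hκ hlam hβ hRE hmin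
        hζ.cross hζ.chi J)
    · positivity
  · exact abs_coord_sub_le hκA (by positivity) hREA (hb A) hβ (hfit A) (hζ.coord j)
  · intro J hJ0
    have hJ : #J ≤ sbar := by
      by_contra h
      exact hJ0 (by rw [hW, if_neg h])
    have hJp : (#J : ℝ) ≤ p ^ 2 := by
      have h : (#J : ℝ) ≤ p := by exact_mod_cast Finset.card_le_univ J
      nlinarith
    have hnoise : ‖(colSpan x J).starProjection ζ‖ ^ 2 ≤ (p * (σ * √((14 + 4 * c) * L))) ^ 2 := by
      refine (hζ.norm_sq J).trans ?_
      rw [mul_pow, mul_pow, Real.sq_sqrt (by positivity)]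
      have : (#J : ℝ) * (σ ^ 2 * ((14 + 4 * c) * L)) ≤ p ^ 2 * (σ ^ 2 * ((14 + 4 * c) * L)) := by
        gcongr
      linarith
    have h1 := abs_coord_le_of_fit hκb (by positivity) (hREb J · hJ) (hb J) (hfit J) hnoise j
    refine (abs_sub _ _).trans ((add_le_add h1 hm).trans ?_)
    rw [mul_add, ← mul_div_assoc, mul_add]
    have h2 : ‖f‖ ≤ p * ‖f‖ := le_mul_of_one_le_left (norm_nonneg _) (by linarith)
    have h3 : m ≤ p * m := le_mul_of_one_le_left hm0 (by linarith)
    gcongr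

end PosteriorMeanError

section Design

variable {n : ℕ} {ι : Type*} [Fintype ι]

lemma toLp_mulVec_eq_sum (X : Matrix (Fin n) ι ℝ) (b : ι → ℝ) :
    WithLp.toLp 2 (X.mulVec b) = ∑ j, b j • WithLp.toLp 2 (fun i => X i j) := by
  ext i
  simp [Matrix.mulVec, dotProduct, mul_comm]

lemma toLp_eq_starProjection [DecidableEq ι] {X : Matrix (Fin n) ι ℝ} {J : Finset ι}
    {v q : Fin n → ℝ}
    (hq : ∃ b : ι → ℝ, (∀ j ∉ J, b j = 0) ∧ q = X.mulVec b)
    (horth : ∀ j ∈ J, ∑ i, (v i - q i) * X i j = 0) :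
    WithLp.toLp 2 q =
      (colSpan (fun j => WithLp.toLp 2 (fun i => X i j)) J).starProjection (WithLp.toLp 2 v) := by
  symm
  refine Submodule.eq_starProjection_of_mem_of_inner_eq_zero ?_ ?_
  · obtain ⟨b, hb, rfl⟩ := hq
    exact mem_colSpan.2 ⟨b, hb, toLp_mulVec_eq_sum X b⟩
  · intro w hw
    obtain ⟨b, hb, rfl⟩ := mem_colSpan.1 hw
    rw [inner_sum]
    refine Finset.sum_eq_zero fun j _ => ?_
    by_cases hj : j ∈ J
    · rw [inner_smul_right, PiLp.inner_apply]
      simp only [PiLp.sub_apply, RCLike.inner_apply, conj_trivial]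
      refine mul_eq_zero_of_right _ (Eq.trans ?_ (horth j hj))
      simp [mul_comm]
    · simp [hb j hj]

lemma sq_mul_sum_sq_le_of_sInf {X : Matrix (Fin n) ι ℝ} {s κ : ℝ} (hn : 1 ≤ n) (hκ0 : 0 ≤ κ)
    (hκ : κ = sInf {r : ℝ | ∃ (J : Finset ι) (u : ι → ℝ),
        (J.card : ℝ) ≤ s ∧ (∀ j ∉ J, u j = 0) ∧ (∑ j, (u j)^2) = 1 ∧
        r = Real.sqrt (∑ i, (X.mulVec u i)^2) / Real.sqrt n})
    {J : Finset ι} {b : ι → ℝ} (hJ : (#J : ℝ) ≤ s) (hb : ∀ j ∉ J, b j = 0) :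
    (√n * κ) ^ 2 * ∑ j, b j ^ 2 ≤ ‖∑ j, b j • WithLp.toLp 2 (fun i => X i j)‖ ^ 2 := by
  rw [← toLp_mulVec_eq_sum, EuclideanSpace.real_norm_sq_eq]
  set S := ∑ j, b j ^ 2
  have hS : 0 ≤ S := Finset.sum_nonneg fun j _ => sq_nonneg (b j)
  rcases hS.eq_or_lt with h0 | h0
  · rw [← h0, mul_zero]
    exact Finset.sum_nonneg fun i _ => sq_nonneg _
  have hn0 : (0 : ℝ) < √n := Real.sqrt_pos.2 (by exact_mod_cast hn)
  have h1 : κ ≤ √(∑ i, (X.mulVec ((√S)⁻¹ • b) i) ^ 2) / √n := by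
    rw [hκ]
    refine csInf_le ⟨0, ?_⟩ ⟨J, (√S)⁻¹ • b, hJ, fun j hj => by simp [hb j hj], ?_, rfl⟩
    · rintro _ ⟨_, _, _, _, _, rfl⟩
      positivity
    · simp only [Pi.smul_apply, smul_eq_mul, mul_pow, ← Finset.mul_sum, inv_pow,
        Real.sq_sqrt hS]
      exact inv_mul_cancel₀ h0.ne'
  simp only [Matrix.mulVec_smul, Pi.smul_apply, smul_eq_mul, mul_pow, ← Finset.mul_sum, inv_pow,
    Real.sq_sqrt hS] at h1
  rw [le_div_iff₀ hn0, mul_comm] at h1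
  have h2 := pow_le_pow_left₀ (by positivity) h1 2
  rw [Real.sq_sqrt (mul_nonneg (by positivity) (Finset.sum_nonneg fun i _ => sq_nonneg _)),
    inv_mul_eq_div, le_div_iff₀ h0] at h2
  exact h2

lemma sInf_design_antitone {X : Matrix (Fin n) ι ℝ} {s t : ℝ} [Nonempty ι]
    (hst : s ≤ t) (hs : 1 ≤ s) :
    sInf {r : ℝ | ∃ (J : Finset ι) (u : ι → ℝ),
        (J.card : ℝ) ≤ t ∧ (∀ j ∉ J, u j = 0) ∧ (∑ j, (u j)^2) = 1 ∧
        r = Real.sqrt (∑ i, (X.mulVec u i)^2) / Real.sqrt n} ≤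
    sInf {r : ℝ | ∃ (J : Finset ι) (u : ι → ℝ),
        (J.card : ℝ) ≤ s ∧ (∀ j ∉ J, u j = 0) ∧ (∑ j, (u j)^2) = 1 ∧
        r = Real.sqrt (∑ i, (X.mulVec u i)^2) / Real.sqrt n} := by
  refine csInf_le_csInf ⟨0, ?_⟩ ?_ ?_
  · rintro _ ⟨_, _, _, _, _, rfl⟩
    positivity
  · classical
    obtain ⟨j⟩ := ‹Nonempty ι›
    refine ⟨_, {j}, Pi.single j 1, by simpa using hs, fun i hi => ?_, ?_, rfl⟩
    · exact Pi.single_eq_of_ne (by simpa using hi) _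
    · simp [Pi.single_apply, ite_pow]
  · rintro _ ⟨J, u, hJ, hu, h1, rfl⟩
    exact ⟨J, u, hJ.trans hst, hu, h1, rfl⟩

end Design

lemma error_bound_le {p N σ c nuA nub F m : ℝ} (hp : 2 ≤ p) (hN : 0 < N) (hσ : 0 < σ) (hc : 0 ≤ c)
    (hnuA : 0 < nuA) (hnub : 0 < nub) (hF : 0 ≤ F) (hm : 0 ≤ m) :
    σ * √(2 * (c + 1) * Real.log p) / (√N * nuA) +
        2 * (p * Real.exp (-((7 + c) * Real.log p))) *
          (p * ((F + σ * √((14 + 4 * c) * Real.log p)) / (√N * nub) + m)) ≤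
      σ * √(2 * (c + 1) * Real.log p / (N * nuA ^ 2)) + 3 / (nub * p ^ c) *
        (σ * √((20 + 4 * c) * Real.log p / N) + F / √N + nub * m) := by
  have hL : 0 ≤ Real.log p := Real.log_nonneg (by linarith)
  have hp0 : 0 < p := by linarith
  have hN' : 0 < √N := Real.sqrt_pos.2 hN
  refine add_le_add (le_of_eq ?_) ?_
  · rw [Real.sqrt_div (by positivity), Real.sqrt_mul hN.le, Real.sqrt_sq hnuA.le, mul_div_assoc]
  have h1 : Real.exp (-((7 + c) * Real.log p)) = (p ^ 7)⁻¹ * (p ^ c)⁻¹ := by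
    rw [Real.rpow_def_of_pos hp0, ← Real.exp_neg, ← Real.rpow_natCast,
      Real.rpow_def_of_pos hp0, ← Real.exp_neg, ← Real.exp_add]
    congr 1
    push_cast
    ring
  have hpc : 0 < p ^ c := Real.rpow_pos_of_pos hp0 c
  have h2 : (F + σ * √((14 + 4 * c) * Real.log p)) / (√N * nub) + m ≤
      (σ * √((20 + 4 * c) * Real.log p / N) + F / √N + nub * m) / nub := by
    have h3 : √((14 + 4 * c) * Real.log p) ≤ √((20 + 4 * c) * Real.log p) := by
      gcongr
      norm_num
    have h4 : σ * √((20 + 4 * c) * Real.log p / N) + F / √N + nub * m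
        = ((F + σ * √((20 + 4 * c) * Real.log p)) / (√N * nub) + m) * nub := by
      rw [Real.sqrt_div (by positivity)]
      field_simp
      ring
    rw [h4, mul_div_cancel_right₀ _ hnub.ne']
    gcongr
  set R := (σ * √((20 + 4 * c) * Real.log p / N) + F / √N + nub * m) / nub with hR
  have hR0 : 0 ≤ R := by positivity
  have h5 : 3 / (nub * p ^ c) * (σ * √((20 + 4 * c) * Real.log p / N) + F / √N + nub * m)
      = 3 * ((p ^ c)⁻¹ * R) := by
    rw [hR]
    field_simp
  have h6 : p ^ 2 * (p ^ 7)⁻¹ ≤ 1 := by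
    rw [mul_inv_le_iff₀ (by positivity), one_mul]
    exact pow_le_pow_right₀ (by linarith) (by norm_num)
  rw [h1, h5]
  calc _ ≤ 2 * (p * ((p ^ 7)⁻¹ * (p ^ c)⁻¹)) * (p * R) := by gcongr
    _ = 2 * (p ^ 2 * (p ^ 7)⁻¹) * ((p ^ c)⁻¹ * R) := by ring
    _ ≤ 3 * ((p ^ c)⁻¹ * R) := by
      gcongr
      linarith

theorem stmt9
    (n p : ℕ) (hn : 1 ≤ n) (hnp : n ≤ p) (hp2 : 2 ≤ p)
    (X : Matrix (Fin n) (Fin p) ℝ)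
    (hX : ∀ j, Real.sqrt (∑ i, (X i j)^2) = Real.sqrt n)
    (σ : ℝ) (hσ : 0 < σ)
    (βs : Fin p → ℝ) (sstar : ℕ) (hs1 : 1 ≤ sstar)
    (Jstar : Finset (Fin p)) (hJstar : Jstar = Finset.univ.filter (fun j => βs j ≠ 0))
    (hcard : Jstar.card = sstar)
    (P : Finset (Fin p) → (Fin n → ℝ) → (Fin n → ℝ))
    (hP : ∀ (J : Finset (Fin p)) (v : Fin n → ℝ),
        (∃ cf : Fin p → ℝ, (∀ j ∉ J, cf j = 0) ∧ P J v = X.mulVec cf)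
        ∧ ∀ j ∈ J, (∑ i, (v i - P J v i) * X i j) = 0)
    (μ : Measure (Fin n → ℝ))
    (hμ : μ = Measure.pi (fun _ : Fin n => gaussianReal 0 (Real.toNNReal (σ^2))))
    (hminimal : ∀ b : Fin p → ℝ, X.mulVec b = X.mulVec βs →
        sstar ≤ (Finset.univ.filter (fun j => b j ≠ 0)).card)
    (y : (Fin n → ℝ) → Fin n → ℝ)
    (hy : ∀ z i, y z i = X.mulVec βs i + z i)
    (sbar : ℕ) (hsbar1 : sstar ≤ sbar) (hsbar2 : sbar ≤ p)
    (lam : ℝ)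
    (w Post : (Fin n → ℝ) → Finset (Fin p) → ℝ)
    (hw : ∀ z J, w z J = if J.card ≤ sbar then
        ((p.choose J.card : ℝ))⁻¹ * Real.exp (-(lam * (J.card : ℝ)))
          * Real.exp (-(∑ i, (y z i - P J (y z) i)^2) / (2 * σ^2)) else 0)
    (hPost : ∀ z J, Post z J = w z J / ∑ J' : Finset (Fin p), w z J')
    (bh : (Fin n → ℝ) → Finset (Fin p) → Fin p → ℝ)
    (hbh : ∀ z J, (∀ j ∉ J, bh z J j = 0)
        ∧ X.mulVec (bh z J) = P J (y z)
        ∧ ∀ b : Fin p → ℝ, (∀ j ∉ J, b j = 0) → X.mulVec b = P J (y z) →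
            ∑ j, (bh z J j)^2 ≤ ∑ j, (b j)^2)
    (nu : ℝ → ℝ)
    (hnu : ∀ s : ℝ, nu s = sInf {r : ℝ | ∃ (J : Finset (Fin p)) (u : Fin p → ℝ),
        (J.card : ℝ) ≤ s ∧ (∀ j ∉ J, u j = 0) ∧ (∑ j, (u j)^2) = 1 ∧
        r = Real.sqrt (∑ i, (X.mulVec u i)^2) / Real.sqrt n})
    (ε c : ℝ) (hε : 0 < ε) (hc : 1 ≤ c)
    (hI : 0 < nu ((2 + ε) * (sstar : ℝ)))
    (hIbar : 0 < nu (sbar : ℝ))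
    (hlam : lam = (((1 + ε) * (23 + 5 * c) + 1) / ε) * Real.log p)
    (hbmin : ∀ j ∈ Jstar,
        3 * σ * Real.sqrt (lam / n) / nu ((2 + ε) * (sstar : ℝ)) ≤ |βs j|)
    :
    ENNReal.ofReal (1 - 4 * (p : ℝ) ^ (-c)) ≤
      μ {z | ∀ j,
        |(∑ J : Finset (Fin p), Post z J * bh z J j) - βs j|
          ≤ σ * Real.sqrt (2 * (c + 1) * Real.log p
                / ((n : ℝ) * (nu (sstar : ℝ))^2))
            + (3 / (nu (sbar : ℝ) * (p : ℝ) ^ c)) *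
              (σ * Real.sqrt ((20 + 4 * c) * Real.log p / (n : ℝ))
                + Real.sqrt (∑ i, (X.mulVec βs i)^2) / Real.sqrt n
                + nu (sbar : ℝ) * (⨆ j', |βs j'|))} := by
  have hp' : (2 : ℝ) ≤ p := by exact_mod_cast hp2
  have hp0 : (0 : ℝ) < p := by linarith
  have hn0 : (0 : ℝ) < n := by exact_mod_cast hn
  have hsn : 0 < √(n : ℝ) := Real.sqrt_pos.2 hn0
  have hs1' : (1 : ℝ) ≤ sstar := by exact_mod_cast hs1
  have : Nonempty (Fin p) := ⟨⟨0, by omega⟩⟩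
  have hpow : (p : ℝ) ^ (-c) = Real.exp (-(c * Real.log p)) := by
    rw [Real.rpow_def_of_pos hp0]
    ring_nf
  have hnuA : 0 < nu sstar := by
    refine hIbar.trans_le ?_
    rw [hnu, hnu]
    exact sInf_design_antitone (by exact_mod_cast hsbar1) hs1'
  set x : Fin p → EuclideanSpace ℝ (Fin n) := fun j => WithLp.toLp 2 (fun i => X i j) with hx
  have hβ : ∀ j ∉ Jstar, βs j = 0 := by
    intro j hj
    simpa [hJstar] using hj
  have hfA : ∑ j, βs j • x j ∈ colSpan x Jstar := mem_colSpan.2 ⟨βs, hβ, rfl⟩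
  have hproj : ∀ J v, WithLp.toLp 2 (P J v) = (colSpan x J).starProjection (WithLp.toLp 2 v) :=
    fun J v => toLp_eq_starProjection (hP J v).1 (hP J v).2
  have hprob := one_sub_le_stdGaussian_isTypicalNoise (by rwa [Fintype.card_fin]) hσ
    (zero_le_one.trans hc) x hfA
  rw [Fintype.card_fin, ← hpow] at hprob
  rw [hμ, pi_gaussianReal_eq_map_stdGaussian]
  refine le_trans ?_ (Measure.le_map_apply (Measurable.aemeasurable (by fun_prop)) _)
  refine (ENNReal.ofReal_le_of_le_toReal hprob).trans (measure_mono fun v hv j => ?_)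
  set z : Fin n → ℝ := WithLp.ofLp (σ • v) with hz
  have hzv : σ • v = WithLp.toLp 2 z := rfl
  have hyz : WithLp.toLp 2 (y z) = ∑ j, βs j • x j + σ • v := by
    rw [hx, ← toLp_mulVec_eq_sum]
    ext i
    simp [hy, hz]
  have hκ : 0 < √n * nu ((2 + ε) * sstar) := by positivity
  have hm : ∀ j, |βs j| ≤ ⨆ j', |βs j'| := le_ciSup (Set.finite_range _).bddAbove
  have hW : ∀ J, w z J = if #J ≤ sbar then
      ((Fintype.card (Fin p)).choose #J : ℝ)⁻¹ * Real.exp (-(lam * #J)) *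
        Real.exp (-‖∑ j, βs j • x j + σ • v -
          (colSpan x J).starProjection (∑ j, βs j • x j + σ • v)‖ ^ 2 / (2 * σ ^ 2)) else 0 := by
    intro J
    rw [hw, Fintype.card_fin, ← hyz, ← hproj, EuclideanSpace.real_norm_sq_eq]
    simp
  have hmin : ∀ j ∈ Jstar, 3 * σ * √lam / (√n * nu ((2 + ε) * sstar)) ≤ |βs j| := by
    intro j hj
    refine le_of_eq_of_le ?_ (hbmin j hj)
    rw [Real.sqrt_div' _ hn0.le]
    field_simp
  have hlam' : ((1 + ε) * (23 + 5 * c) + 1) / ε * Real.log (Fintype.card (Fin p)) = lam := by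
    rw [Fintype.card_fin, hlam]
  have key := IsTypicalNoise.abs_posterior_mean_sub_le (W := w z) (b := bh z)
    (κA := √n * nu sstar) (κb := √n * nu sbar)
    (by rw [Fintype.card_fin]; exact hv) (by rwa [Fintype.card_fin]) hσ hε
    (zero_le_one.trans hc) hκ (by positivity) (by positivity) hlam' hβ (by omega)
    (fun J b hJ => sq_mul_sum_sq_le_of_sInf hn hI.le (hnu _) (by rwa [hcard] at hJ))
    (fun b => sq_mul_sum_sq_le_of_sInf hn hnuA.le (hnu _) (by rw [hcard]))
    (fun J b hJ => sq_mul_sum_sq_le_of_sInf hn hIbar.le (hnu _) (by exact_mod_cast hJ))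
    hmin hW (fun J => (hbh z J).1)
    (fun J => by rw [← hyz, ← hproj, ← (hbh z J).2.1, toLp_mulVec_eq_sum]) (hm j)
  rw [Fintype.card_fin] at key
  have hF : √(∑ i, (X.mulVec βs i) ^ 2) = ‖∑ j, βs j • x j‖ := by
    rw [hx, ← toLp_mulVec_eq_sum, EuclideanSpace.norm_eq]
    simp
  simp only [hPost, hF]
  exact key.trans (error_bound_le hp' hn0 hσ (zero_le_one.trans hc) hnuA hIbar (norm_nonneg _)
    ((abs_nonneg _).trans (hm j)))
end

section
/- For any c > 0, with probability at least 1 − p^(−c) over the Gaussian noise z, simultaneously for every subset J ⊆ {1,…,p} with J ≠ J⋆, writing s = |J| and t = |J ∩ J⋆|: ⟨P_J^⊥(Xβ⋆), z⟩² ≤ (10 + 2c)·σ²·(max(s, s⋆) − t)·(log p)·‖P_J^⊥(Xβ⋆)‖₂². -/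
open MeasureTheory ProbabilityTheory Finset
open scoped Classical ENNReal

/-- A linear form in i.i.d. centered Gaussian coordinates is sub-Gaussian. -/
lemma hasSubgaussianMGF_sum_mul_pi_gaussianReal {ι : Type*} [Fintype ι] (v : NNReal) (w : ι → ℝ) :
    HasSubgaussianMGF (fun z : ι → ℝ => ∑ i, w i * z i)
      (∑ i, ⟨w i ^ 2, sq_nonneg (w i)⟩ * v) (Measure.pi fun _ => gaussianReal 0 v) := by
  have hid : HasSubgaussianMGF (fun x : ℝ => x) v (gaussianReal 0 v) :=
    ⟨integrable_exp_mul_gaussianReal, fun t => by simp [mgf_fun_id_gaussianReal]⟩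
  refine HasSubgaussianMGF.sum_of_iIndepFun
    (iIndepFun_pi (X := fun i x => w i * x) fun i => by fun_prop) fun i _ => ?_
  have hmap : (Measure.pi fun _ : ι => gaussianReal 0 v).map (fun z => z i) = gaussianReal 0 v :=
    (measurePreserving_eval (fun _ : ι => gaussianReal 0 v) i).map_eq
  have h := hid.const_mul (w i)
  rw [← hmap] at h
  exact h.of_map (measurable_pi_apply i).aemeasurable

/-- Two-sided Gaussian tail bound for a linear form, in squared form. -/
lemma measureReal_pi_gaussianReal_lt_sq_le {ι : Type*} [Fintype ι] {v : NNReal} (hv : v ≠ 0)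
    (w : ι → ℝ) {τ : ℝ} (hτ : 0 ≤ τ) :
    (Measure.pi fun _ : ι => gaussianReal 0 v).real
      {z | τ * (v * ∑ i, w i ^ 2) < (∑ i, w i * z i) ^ 2} ≤ 2 * Real.exp (-τ / 2) := by
  have hsub := hasSubgaussianMGF_sum_mul_pi_gaussianReal v w
  set C : NNReal := ∑ i, ⟨w i ^ 2, sq_nonneg (w i)⟩ * v with hC
  have hCval : (C : ℝ) = v * ∑ i, w i ^ 2 := by
    rw [hC, NNReal.coe_sum, mul_sum]
    exact sum_congr rfl fun i _ => mul_comm _ _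
  rcases eq_or_ne C 0 with h0 | h0
  · have hw : ∀ i, w i = 0 := by
      have : ∑ i, w i ^ 2 = 0 := by
        have h : (v : ℝ) * ∑ i, w i ^ 2 = 0 := by rw [← hCval, h0]; rfl
        exact (mul_eq_zero.mp h).resolve_left (by exact_mod_cast hv)
      intro i
      have := (sum_eq_zero_iff_of_nonneg fun i _ => sq_nonneg (w i)).mp this i (mem_univ i)
      exact pow_eq_zero_iff two_ne_zero |>.mp this
    simp only [hw]
    simp only [ne_eq, OfNat.ofNat_ne_zero, not_false_eq_true, zero_pow, sum_const_zero, mul_zero,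
      zero_mul, lt_self_iff_false, Set.ofPred_false, measureReal_empty]
    positivity
  · have hCpos : (0 : ℝ) < C := by exact_mod_cast pos_iff_ne_zero.mpr h0
    have hexp : -Real.sqrt (τ * C) ^ 2 / (2 * C) = -τ / 2 := by
      rw [Real.sq_sqrt (by positivity)]
      field_simp
    have h1 := hsub.measure_ge_le (Real.sqrt_nonneg (τ * C))
    have h2 := hsub.neg.measure_ge_le (Real.sqrt_nonneg (τ * C))
    rw [hexp] at h1 h2
    calc _ ≤ (Measure.pi fun _ : ι => gaussianReal 0 v).real
          ({z | Real.sqrt (τ * C) ≤ ∑ i, w i * z i} ∪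
            {z | Real.sqrt (τ * C) ≤ (-fun z : ι → ℝ => ∑ i, w i * z i) z}) := by
          refine measureReal_mono fun z hz => ?_
          rw [Set.mem_ofPred_eq, ← hCval] at hz
          exact le_abs.mp (Real.sqrt_le_sqrt hz.le |>.trans_eq (Real.sqrt_sq_eq_abs _))
      _ ≤ _ := measureReal_union_le _ _
      _ ≤ _ := by linarith

lemma card_symmDiff_le_two_mul_max_sub {α : Type*} [DecidableEq α] (s t : Finset α) :
    (symmDiff s t).card ≤ 2 * (max s.card t.card - (s ∩ t).card) := by
  have h1 := card_sdiff_add_card_inter s t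
  have h2 := card_sdiff_add_card_inter t s
  have h3 : (symmDiff s t).card ≤ (s \ t).card + (t \ s).card := card_union_le _ _
  rw [inter_comm t s] at h2
  have h4 := le_max_left s.card t.card
  have h5 := le_max_right s.card t.card
  lia

lemma sum_pow_card_symmDiff {α : Type*} [Fintype α] [DecidableEq α] (t : Finset α) (r : ℝ) :
    ∑ s ∈ univ.filter (· ≠ t), r ^ (symmDiff s t).card = (1 + r) ^ Fintype.card α - 1 := by
  have h : ∑ s : Finset α, r ^ (symmDiff s t).card = (1 + r) ^ Fintype.card α := by
    have h1 := Fintype.sum_pow_mul_eq_add_pow α r 1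
    simp only [one_pow, mul_one] at h1
    rw [add_comm, ← h1]
    exact Equiv.sum_comp (Function.Involutive.toPerm (fun s => symmDiff s t)
      fun s => symmDiff_symmDiff_cancel_right t s) fun s => r ^ s.card
  rw [filter_ne', ← h, ← sum_erase_add univ _ (mem_univ t)]
  simp

lemma two_mul_one_add_pow_sub_one_le_one {p : ℕ} (hp : 2 ≤ p) :
    2 * ((1 + Real.exp (-(5 / 2) * Real.log p)) ^ p - 1) ≤ 1 := by
  have hp' : (2 : ℝ) ≤ p := by exact_mod_cast hp
  set r := Real.exp (-(5 / 2) * Real.log p) with hr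
  have hr0 : 0 < r := Real.exp_pos _
  have hpr : (p * r) ^ 2 ≤ 1 / 8 := by
    have h : (p * r) ^ 2 = (p ^ 3 : ℝ)⁻¹ := by
      have hp0 : (0 : ℝ) < p := by linarith
      rw [hr]
      nth_rewrite 1 [← Real.exp_log hp0]
      nth_rewrite 3 [← Real.exp_log hp0]
      rw [← Real.exp_add, ← Real.exp_nat_mul, ← Real.exp_nat_mul, ← Real.exp_neg]
      congr 1
      push_cast
      ring
    rw [h, one_div]
    gcongr
    calc (8 : ℝ) = 2 ^ 3 := by norm_num
      _ ≤ _ := by gcongr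
  have hpr' : p * r ≤ 0.36 := by
    by_contra! h
    nlinarith
  have h1 : (1 + r) ^ p ≤ Real.exp (p * r) := by
    rw [Real.exp_nat_mul]
    gcongr
    linarith [Real.add_one_le_exp r]
  have h2 : Real.exp (-0.18) ≥ 0.82 := by linarith [Real.add_one_le_exp (-0.18 : ℝ)]
  have h3 : Real.exp (p * r) ≤ 3 / 2 := by
    have h4 : Real.exp 0.36 * Real.exp (-0.18) ^ 2 = 1 := by
      rw [← Real.exp_nat_mul, ← Real.exp_add]
      norm_num
    have h5 : Real.exp (p * r) ≤ Real.exp 0.36 := Real.exp_le_exp.mpr hpr'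
    have h6 : (0.82 : ℝ) ^ 2 ≤ Real.exp (-0.18) ^ 2 := by gcongr
    nlinarith [Real.exp_pos 0.36]
  linarith

theorem stmt12
    (n p : ℕ) (hn : 1 ≤ n) (hnp : n ≤ p) (hp2 : 2 ≤ p)
    (X : Matrix (Fin n) (Fin p) ℝ)
    (hX : ∀ j, Real.sqrt (∑ i, (X i j)^2) = Real.sqrt n)
    (σ : ℝ) (hσ : 0 < σ)
    (P : Finset (Fin p) → (Fin n → ℝ) → (Fin n → ℝ))
    (hP : ∀ (J : Finset (Fin p)) (v : Fin n → ℝ),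
        (∃ cf : Fin p → ℝ, (∀ j ∉ J, cf j = 0) ∧ P J v = X.mulVec cf)
        ∧ ∀ j ∈ J, (∑ i, (v i - P J v i) * X i j) = 0)
    (μ : Measure (Fin n → ℝ))
    (hμ : μ = Measure.pi (fun _ : Fin n => gaussianReal 0 (Real.toNNReal (σ^2))))
    (βs : Fin p → ℝ) (sstar : ℕ) (hs1 : 1 ≤ sstar)
    (Jstar : Finset (Fin p)) (hJstar : Jstar = Finset.univ.filter (fun j => βs j ≠ 0))
    (hcard : Jstar.card = sstar)
    (c : ℝ) (hc : 0 < c)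
    :
    ENNReal.ofReal (1 - (p : ℝ) ^ (-c)) ≤
      μ {z | ∀ J : Finset (Fin p), J ≠ Jstar →
        (∑ i, (X.mulVec βs i - P J (X.mulVec βs) i) * z i)^2
          ≤ (10 + 2 * c) * σ^2 * ((max J.card sstar - (J ∩ Jstar).card : ℕ) : ℝ)
              * Real.log p * ∑ i, (X.mulVec βs i - P J (X.mulVec βs) i)^2} := by
  set v : NNReal := Real.toNNReal (σ ^ 2) with hvdef
  have hv : (v : ℝ) = σ ^ 2 := Real.coe_toNNReal _ (sq_nonneg σ)
  have hv0 : v ≠ 0 := by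
    rw [← NNReal.coe_ne_zero, hv]
    positivity
  have hprob : IsProbabilityMeasure μ := by rw [hμ]; infer_instance
  have hlog : 0 ≤ Real.log p := Real.log_natCast_nonneg p
  have hp0 : (0 : ℝ) < p := by exact_mod_cast (by lia : 0 < p)
  set r := Real.exp (-(5 / 2) * Real.log p) with hr
  set w : Finset (Fin p) → Fin n → ℝ := fun J i =>
    X.mulVec βs i - P J (X.mulVec βs) i with hw
  set k : Finset (Fin p) → ℕ := fun J => max J.card sstar - (J ∩ Jstar).card with hk
  set τ : Finset (Fin p) → ℝ := fun J => (10 + 2 * c) * k J * Real.log p with hτ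
  set B : Finset (Fin p) → Set (Fin n → ℝ) := fun J =>
    {z | τ J * (v * ∑ i, w J i ^ 2) < (∑ i, w J i * z i) ^ 2} with hB
  have hbound : ∀ J ∈ univ.filter (· ≠ Jstar),
      μ.real (B J) ≤ (p : ℝ) ^ (-c) * (2 * r ^ (symmDiff J Jstar).card) := by
    intro J hJ
    have hd := card_symmDiff_le_two_mul_max_sub J Jstar
    have hd0 : 0 < (symmDiff J Jstar).card := by
      rw [card_pos, nonempty_iff_ne_empty]
      exact fun h => (mem_filter.mp hJ).2 (symmDiff_eq_bot.mp h)
    rw [hcard] at hd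
    have hk1 : (1 : ℝ) ≤ k J := by exact_mod_cast (by lia : 1 ≤ k J)
    have hdk : ((symmDiff J Jstar).card : ℝ) ≤ 2 * k J := by exact_mod_cast hd
    have htail := measureReal_pi_gaussianReal_lt_sq_le hv0 (w J) (τ := τ J) (by positivity)
    rw [← hμ] at htail
    refine htail.trans ?_
    rw [Real.rpow_def_of_pos hp0, hr, ← Real.exp_nat_mul, mul_left_comm, ← Real.exp_add]
    gcongr
    have h1 : c * Real.log p ≤ c * Real.log p * k J := le_mul_of_one_le_right (by positivity) hk1
    have h2 := mul_le_mul_of_nonneg_right hdk hlog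
    simp only [hτ]
    linarith
  have hunion : μ.real (⋃ J ∈ univ.filter (· ≠ Jstar), B J) ≤ (p : ℝ) ^ (-c) := by
    calc _ ≤ ∑ J ∈ univ.filter (· ≠ Jstar), μ.real (B J) := measureReal_biUnion_finset_le _ _
      _ ≤ ∑ J ∈ univ.filter (· ≠ Jstar), (p : ℝ) ^ (-c) * (2 * r ^ (symmDiff J Jstar).card) :=
          sum_le_sum hbound
      _ = (p : ℝ) ^ (-c) * (2 * ((1 + r) ^ p - 1)) := by
          rw [← mul_sum, ← mul_sum, sum_pow_card_symmDiff, Fintype.card_fin]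
      _ ≤ _ := mul_le_of_le_one_right (by positivity) (two_mul_one_add_pow_sub_one_le_one hp2)
  rw [ENNReal.ofReal_le_iff_le_toReal (measure_ne_top _ _)]
  change _ ≤ μ.real _
  set S := {z : Fin n → ℝ | ∀ J : Finset (Fin p), J ≠ Jstar →
    (∑ i, w J i * z i) ^ 2 ≤
      (10 + 2 * c) * σ ^ 2 * (k J : ℝ) * Real.log p * ∑ i, w J i ^ 2} with hS
  have hcover : S ∪ ⋃ J ∈ univ.filter (· ≠ Jstar), B J = Set.univ := by
    refine Set.eq_univ_of_forall fun z => or_iff_not_imp_right.mpr fun hz J hJ => ?_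
    by_contra! hlt
    refine hz (Set.mem_biUnion (x := J) (by simpa using hJ) ?_)
    refine lt_of_eq_of_lt ?_ hlt
    rw [hv]
    ring
  have h1 : μ.real (S ∪ ⋃ J ∈ univ.filter (· ≠ Jstar), B J) = 1 := by
    rw [hcover, probReal_univ]
  linarith [measureReal_union_le (μ := μ) S (⋃ J ∈ univ.filter (· ≠ Jstar), B J)]
end
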